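/- Impact of teacher overfitting on vanilla KD (Proposition 2, lower-bound ingredient). Let (X,Y) be a random pair with Y∈{e_1,…,e_k} one-hot and Bayes probabilities p0(x)=E[Y|X=x] taking values with p0_j(X)∈(0,1] almost surely. Fix ε∈(0,1) with ε < (1/4)·E[p0_j(X)·(1−p0_j(X))²] / E[(1−p0_j(X))/p0_j(X)] for each j∈[k]. With an interpolating teacher (p̃(x_i)=y_i on the training points so that max(p̃_j(x_i),ε)=max(y_{i,j},ε)), the vanilla-KD SEL student over constant prediction rules is f̂ = (1/n)Σ_{i=1}^n log(max(y_i, ε)) componentwise, while the optimal constant rule is f0 = E[log p0(X)]. Then for every j∈[k]: f0_j − E[f̂_j] = E[log p0_j(X)] − E[log max(Y_j, ε)] ≥ (1/4)·E[p0_j(X)·(1−p0_j(X))²]. In particular, when the right-hand side is positive, the vanilla-KD error ‖f̂ − f0‖_{2,2}² is bounded below by a non-vanishing constant independent of n (with high probability). -/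

import Mathlib

open MeasureTheory ProbabilityTheory Real Set
open scoped RealInnerProductSpace

noncomputable section

abbrev Vec (k : ℕ) := EuclideanSpace ℝ (Fin k)

/-- turn a plain function into a Euclidean vector -/
def vecOf {k : ℕ} (g : Fin k → ℝ) : Vec k := (WithLp.equiv 2 (Fin k → ℝ)).symm g

/-- matrix-vector product as Euclidean vectors -/
def mulVecE {m n : ℕ} (A : Matrix (Fin m) (Fin n) ℝ) (v : EuclideanSpace ℝ (Fin n)) :
    EuclideanSpace ℝ (Fin m) :=
  (WithLp.equiv 2 (Fin m → ℝ)).symm (A.mulVec (WithLp.equiv 2 (Fin n → ℝ) v))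

/-- transposed matrix-vector product `Aᵀ v` -/
def tmulVec {m n : ℕ} (A : Matrix (Fin m) (Fin n) ℝ) (v : EuclideanSpace ℝ (Fin m)) :
    EuclideanSpace ℝ (Fin n) :=
  mulVecE A.transpose v

/-- `‖g‖_{2,q} = E[‖g(X)‖₂^q]^{1/q}` -/
def lpq {𝒳 : Type*} [MeasurableSpace 𝒳] {E : Type*} [NormedAddCommGroup E]
    (μ : Measure 𝒳) (q : ℝ) (g : 𝒳 → E) : ℝ :=
  (∫ x, ‖g x‖ ^ q ∂μ) ^ (1 / q)

/-- gradient of the loss in its second (prediction) argument -/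
def gradPhi {𝒳 : Type*} {k : ℕ} (ℓ : 𝒳 → Vec k → Vec k → Vec k → ℝ)
    (x : 𝒳) (y φ pv : Vec k) : Vec k :=
  gradient (fun φ' => ℓ x y φ' pv) φ

/-- cross-derivative matrix `[∇_{φπ} ℓ]_{i,j} = ∂²ℓ/∂φ_j∂π_i` -/
def crossDeriv {𝒳 : Type*} {k : ℕ} (ℓ : 𝒳 → Vec k → Vec k → Vec k → ℝ)
    (x : 𝒳) (y φ pv : Vec k) : Matrix (Fin k) (Fin k) ℝ :=
  fun i j => fderiv ℝ (fun pv' => gradPhi ℓ x y φ pv') pv (EuclideanSpace.single i 1) j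

/-- conditional expectation `q_{f,p}(x) = E[∇_{φπ} ℓ(Z;f(X),p(X)) | X = x]` -/
def qMat {𝒳 : Type*} [MeasurableSpace 𝒳] {k : ℕ} (κ : 𝒳 → Measure (Vec k))
    (ℓ : 𝒳 → Vec k → Vec k → Vec k → ℝ) (f p : 𝒳 → Vec k) (x : 𝒳) :
    Matrix (Fin k) (Fin k) ℝ :=
  fun i j => ∫ y, crossDeriv ℓ x y (f x) (p x) i j ∂(κ x)

/-- `γ_{f,p}(x) = E_{U~Unif[0,1]}[q_{f,Up+(1-U)p0}(x)]` -/
def gammaMat {𝒳 : Type*} [MeasurableSpace 𝒳] {k : ℕ} (κ : 𝒳 → Measure (Vec k))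
    (ℓ : 𝒳 → Vec k → Vec k → Vec k → ℝ) (p0 f p : 𝒳 → Vec k) (x : 𝒳) :
    Matrix (Fin k) (Fin k) ℝ :=
  fun i j =>
    ∫ u in (0:ℝ)..1, qMat κ ℓ f (fun x' => u • p x' + (1 - u) • p0 x') x i j

/-- sign associated to a boolean Rademacher variable -/
def signVal (b : Bool) : ℝ := if b then 1 else -1

/-- localized Rademacher complexity of a function class -/
def localRademacher {Z : Type*} [MeasurableSpace Z] (μZ : Measure Z) (n : ℕ)
    (G : Set (Z → ℝ)) (δ : ℝ) : ℝ :=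
  ∫ z : Fin n → Z,
    ∫ ε : Fin n → Bool,
      (⨆ g : {g : Z → ℝ // g ∈ G ∧ (∫ w, (g w) ^ 2 ∂μZ) ^ ((1:ℝ)/2) ≤ δ},
        (1 / (n : ℝ)) * ∑ i, signVal (ε i) * (g : Z → ℝ) (z i))
      ∂((PMF.uniformOfFintype (Fin n → Bool)).toMeasure)
    ∂(Measure.pi fun _ => μZ)

/-- critical radius: smallest positive solution of `R(δ;G) ≤ δ²/H` -/
def criticalRadius {Z : Type*} [MeasurableSpace Z] (μZ : Measure Z) (n : ℕ)
    (G : Set (Z → ℝ)) (H : ℝ) : ℝ :=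
  sInf {δ : ℝ | 0 < δ ∧ localRademacher μZ n G δ ≤ δ ^ 2 / H}

theorem aux_g (p : ℝ) (h0 : 0 < p) (h1 : p ≤ 1) :
    (1/2) * (p * (1 - p) ^ 2) ≤ p * Real.log p + 1 - p := by
  have hanti : AntitoneOn (fun x : ℝ => Real.log x + x⁻¹ - (1 - x) ^ 2 / 2) (Ioc 0 1) := by
    have hd : ∀ x : ℝ, 0 < x → HasDerivAt (fun x : ℝ => Real.log x + x⁻¹ - (1 - x) ^ 2 / 2)
        (x⁻¹ + (-(x ^ 2)⁻¹) - (2 * (1 - x) * (-1)) / 2) x := by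
      intro x hx
      have h3 : HasDerivAt (fun x : ℝ => (1 - x) ^ 2 / 2) ((2 * (1 - x) * (-1)) / 2) x := by
        have := (((hasDerivAt_id x).const_sub 1).pow 2).div_const 2
        simpa using this
      exact ((Real.hasDerivAt_log hx.ne').add (hasDerivAt_inv hx.ne')).sub h3
    apply antitoneOn_of_deriv_nonpos (convex_Ioc 0 1)
    · exact fun x hx => (hd x hx.1).continuousAt.continuousWithinAt
    · rw [interior_Ioc]
      exact fun x hx => (hd x hx.1).differentiableAt.differentiableWithinAt
    · rw [interior_Ioc]
      intro x hx
      rw [(hd x hx.1).deriv]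
      have hx0 := hx.1
      have : x⁻¹ + (-(x ^ 2)⁻¹) - (2 * (1 - x) * (-1)) / 2 = -((1 - x) ^ 2 * (1 + x) / x ^ 2) := by
        field_simp
        ring
      rw [this]
      have : 0 ≤ (1 - x) ^ 2 * (1 + x) / x ^ 2 := by positivity
      linarith
  have h := hanti (show p ∈ Ioc (0:ℝ) 1 from ⟨h0, h1⟩) (show (1:ℝ) ∈ Ioc (0:ℝ) 1 by simp) h1
  simp at h
  have h2 := mul_le_mul_of_nonneg_left h h0.le
  have h3 : p * p⁻¹ = 1 := mul_inv_cancel₀ h0.ne'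
  nlinarith

theorem aux_pt (p ε : ℝ) (h0 : 0 < p) (h1 : p ≤ 1) (hε : 0 < ε) :
    (1/2) * (p * (1 - p) ^ 2) - ε * ((1 - p) / p) ≤ Real.log p - (1 - p) * Real.log ε := by
  have hg := aux_g p h0 h1
  have hl := Real.log_le_sub_one_of_pos (div_pos hε h0)
  rw [Real.log_div hε.ne' h0.ne'] at hl
  have h2 := mul_le_mul_of_nonneg_left hl (sub_nonneg.2 h1)
  have h3 : ε * ((1 - p) / p) = (1 - p) * (ε / p) := by ring
  rw [h3]
  nlinarith

/-- **Proposition 2 (lower-bound ingredient): impact of teacher overfitting on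
vanilla KD.** With an interpolating teacher, the constant SEL student
`f̂ = (1/n)Σᵢ log(max(yᵢ, ε))` is biased away from the optimal constant rule
`f0 = E[log p0(X)]` by a non-vanishing constant. -/
theorem teacher_overfitting_vanilla_kd
    {𝒳 : Type*} [MeasurableSpace 𝒳] {k : ℕ} (n : ℕ) (hn : 0 < n)
    (μ : Measure 𝒳) [IsProbabilityMeasure μ]
    (κ : ProbabilityTheory.Kernel 𝒳 (Vec k)) [ProbabilityTheory.IsMarkovKernel κ]
    (p0 : 𝒳 → Vec k) (hp0 : ∀ x, p0 x = ∫ y, y ∂(κ x))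
    -- labels are one-hot and Bayes probabilities are in (0,1] almost surely
    (honehot : ∀ᵐ x ∂μ, ∀ᵐ y ∂(κ x), ∃ j, y = EuclideanSpace.single j (1:ℝ))
    (hpos : ∀ᵐ x ∂μ, ∀ j, p0 x j ∈ Ioc (0:ℝ) 1)
    -- integrability of the relevant Bayes-probability functionals
    (hint1 : ∀ j, Integrable (fun x => Real.log (p0 x j)) μ)
    (hint2 : ∀ j, Integrable (fun x => (1 - p0 x j) / p0 x j) μ)
    -- the threshold ε is small compared to the label noise
    (ε : ℝ) (hε : ε ∈ Ioo (0:ℝ) 1)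
    (hεsmall : ∀ j : Fin k, ε <
      (1/4) * (∫ x, p0 x j * (1 - p0 x j) ^ 2 ∂μ) /
        (∫ x, (1 - p0 x j) / p0 x j ∂μ)) :
    -- the interpolating-teacher student and the optimal constant rule
    (let fhat : (Fin n → 𝒳 × Vec k) → Fin k → ℝ := fun d j =>
       (1 / (n : ℝ)) * ∑ i, Real.log (max ((d i).2 j) ε);
     let f0 : Fin k → ℝ := fun j => ∫ x, Real.log (p0 x j) ∂μ;
     ∀ j : Fin k,
       f0 j - (∫ d, fhat d j ∂(Measure.pi fun _ : Fin n => μ ⊗ₘ κ)) =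
         (∫ x, Real.log (p0 x j) ∂μ) -
           (∫ x, ∫ y, Real.log (max (y j) ε) ∂(κ x) ∂μ) ∧
       (1/4) * (∫ x, p0 x j * (1 - p0 x j) ^ 2 ∂μ) ≤
         f0 j - (∫ d, fhat d j ∂(Measure.pi fun _ : Fin n => μ ⊗ₘ κ))) := by
  intro fhat f0 j
  have hε0 := hε.1
  have hε1 := hε.2
  set g : Vec k → ℝ := fun y => Real.log (max (y j) ε) with hg
  have hgm : Measurable g := by
    have : Measurable (fun y : Vec k => y j) := (EuclideanSpace.proj (𝕜 := ℝ) j).continuous.measurable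
    exact Real.measurable_log.comp (this.max measurable_const)
  -- one-hot set
  have hgoh : ∀ y : Vec k, (∃ j, y = EuclideanSpace.single j (1:ℝ)) →
      g y = (1 - y j) * Real.log ε := by
    rintro y ⟨i, rfl⟩
    by_cases hij : j = i
    · simp [hg, hij, max_eq_left hε1.le]
    · simp [hg, hij, max_eq_right hε0.le]
  have hyoh : ∀ y : Vec k, (∃ j, y = EuclideanSpace.single j (1:ℝ)) → ‖y‖ ≤ 1 := by
    rintro y ⟨i, rfl⟩
    simp
  have hgb : ∀ y : Vec k, (∃ j, y = EuclideanSpace.single j (1:ℝ)) → ‖g y‖ ≤ ‖Real.log ε‖ := by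
    rintro y ⟨i, rfl⟩
    by_cases hij : j = i
    · simp [hg, hij, max_eq_left hε1.le]
    · simp [hg, hij, max_eq_right hε0.le]
  have hms : MeasurableSet {y : Vec k | ∃ j, y = EuclideanSpace.single j (1:ℝ)} := by
    have : {y : Vec k | ∃ j, y = EuclideanSpace.single j (1:ℝ)} =
        Set.range (fun j : Fin k => EuclideanSpace.single j (1:ℝ)) := by
      ext y; simp [eq_comm]
    rw [this]
    exact (Set.finite_range _).measurableSet
  have hae : ∀ᵐ z ∂(μ ⊗ₘ κ), ∃ j, z.2 = EuclideanSpace.single j (1:ℝ) :=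
    Measure.ae_compProd_of_ae_ae (measurable_snd hms) honehot
  have hGint : Integrable (fun z : 𝒳 × Vec k => g z.2) (μ ⊗ₘ κ) := by
    refine Integrable.of_bound (hgm.comp measurable_snd).aestronglyMeasurable ‖Real.log ε‖ ?_
    filter_upwards [hae] with z hz using hgb _ hz
  have hpi : ∫ d, fhat d j ∂(Measure.pi fun _ : Fin n => μ ⊗ₘ κ) = ∫ x, ∫ y, g y ∂(κ x) ∂μ := by
    have h1 : ∀ i : Fin n, ∫ d : Fin n → 𝒳 × Vec k, g (d i).2 ∂(Measure.pi fun _ : Fin n => μ ⊗ₘ κ)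
        = ∫ z, g z.2 ∂(μ ⊗ₘ κ) := fun i =>
      integral_comp_eval (μ := fun _ : Fin n => μ ⊗ₘ κ) (f := fun z : 𝒳 × Vec k => g z.2) hGint.aestronglyMeasurable
    have h2 : ∀ i : Fin n, Integrable (fun d : Fin n → 𝒳 × Vec k => g (d i).2)
        (Measure.pi fun _ : Fin n => μ ⊗ₘ κ) := fun i =>
      integrable_comp_eval (μ := fun _ : Fin n => μ ⊗ₘ κ) (f := fun z : 𝒳 × Vec k => g z.2) hGint
    have h3 : ∫ d, fhat d j ∂(Measure.pi fun _ : Fin n => μ ⊗ₘ κ) =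
        ∫ d : Fin n → 𝒳 × Vec k, (1 / (n:ℝ)) * ∑ i, g (d i).2
          ∂(Measure.pi fun _ : Fin n => μ ⊗ₘ κ) := rfl
    rw [h3, integral_const_mul, integral_finsetSum _ (fun i _ => h2 i)]
    simp_rw [h1]
    rw [Measure.integral_compProd hGint]
    have : (n:ℝ) ≠ 0 := by positivity
    simp [this]
  have hinner : ∀ᵐ x ∂μ, ∫ y, g y ∂(κ x) = (1 - p0 x j) * Real.log ε := by
    filter_upwards [honehot] with x hx
    have hid : Integrable (fun y : Vec k => y) (κ x) := by
      refine Integrable.of_bound measurable_id.aestronglyMeasurable 1 ?_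
      filter_upwards [hx] with y hy using hyoh y hy
    have hc : ∫ y : Vec k, y j ∂(κ x) = p0 x j := by
      rw [hp0 x]
      exact (EuclideanSpace.proj (𝕜 := ℝ) j).integral_comp_comm hid
    have hci : Integrable (fun y : Vec k => y j) (κ x) :=
      (EuclideanSpace.proj (𝕜 := ℝ) j).integrable_comp hid
    rw [integral_congr_ae (g := fun y : Vec k => (1 - y j) * Real.log ε)
      (by filter_upwards [hx] with y hy using hgoh y hy),
      integral_mul_const, integral_sub (integrable_const _) hci, hc]
    simp
  have hpm : AEStronglyMeasurable (fun x => p0 x j) μ := by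
    have h := (Real.measurable_exp.comp_aemeasurable (hint1 j).aestronglyMeasurable.aemeasurable)
    refine (h.congr ?_).aestronglyMeasurable
    filter_upwards [hpos] with x hx
    exact Real.exp_log (hx j).1
  have hpint : Integrable (fun x => p0 x j) μ := by
    refine Integrable.of_bound hpm 1 ?_
    filter_upwards [hpos] with x hx
    rw [Real.norm_eq_abs, abs_of_pos (hx j).1]
    exact (hx j).2
  have hAint : Integrable (fun x => p0 x j * (1 - p0 x j) ^ 2) μ := by
    refine Integrable.of_bound (hpm.mul ((aestronglyMeasurable_const.sub hpm).pow 2)) 1 ?_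
    filter_upwards [hpos] with x hx
    have h1 := (hx j).1
    have h2 := (hx j).2
    rw [Real.norm_eq_abs, abs_of_nonneg (by positivity)]
    have : (1 - p0 x j) ^ 2 ≤ 1 := by nlinarith
    nlinarith [sq_nonneg (1 - p0 x j)]
  refine ⟨by rw [hpi], ?_⟩
  rw [hpi, integral_congr_ae hinner]
  have hLint : Integrable (fun x => (1 - p0 x j) * Real.log ε) μ :=
    ((integrable_const _).sub hpint).mul_const _
  have hB0 : 0 ≤ ∫ x, (1 - p0 x j) / p0 x j ∂μ := by
    apply integral_nonneg_of_ae
    filter_upwards [hpos] with x hx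
    exact div_nonneg (sub_nonneg.2 (hx j).2) (hx j).1.le
  have hs := hεsmall j
  have hεB : ε * (∫ x, (1 - p0 x j) / p0 x j ∂μ) ≤ (1/4) * ∫ x, p0 x j * (1 - p0 x j) ^ 2 ∂μ := by
    rcases hB0.eq_or_lt with h | h
    · rw [← h, div_zero] at hs
      linarith
    · exact ((lt_div_iff₀ h).1 hs).le
  have hmain : ∫ x, ((1/2) * (p0 x j * (1 - p0 x j) ^ 2) - ε * ((1 - p0 x j) / p0 x j)) ∂μ ≤
      ∫ x, (Real.log (p0 x j) - (1 - p0 x j) * Real.log ε) ∂μ := by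
    apply integral_mono_ae ((hAint.const_mul _).sub ((hint2 j).const_mul _)) ((hint1 j).sub hLint)
    filter_upwards [hpos] with x hx
    exact aux_pt _ _ (hx j).1 (hx j).2 hε0
  rw [integral_sub (hAint.const_mul _) ((hint2 j).const_mul _), integral_sub (hint1 j) hLint,
    integral_const_mul, integral_const_mul] at hmain
  change _ ≤ (∫ x, Real.log (p0 x j) ∂μ) - _
  linarith
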